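/- arXiv:2101.03191 — 7 statements merged into one kernel-verified Lean document; each statement's English description precedes it below -/
import Mathlib

section
/- Let h be a Hessenberg function on {1,…,n}, let λ = (λ_1, λ_2) be a composition of n with two positive parts, and let 0 ≤ k ≤ λ_2. If λ_1 > 1, assume in addition that h(k+2) = n. Then f_λ^{(k)} satisfies the GKM conditions for h: for every w ∈ S_n and every pair i > j with w(i) < w(j) and i ≤ h(j), the polynomial t_{w(i)} − t_{w(j)} divides f_λ^{(k)}(w) − f_λ^{(k)}(w τ_{ij}) in R. -/
open MvPolynomial Finset

/-- Membership in the Young subgroup `S_λ` for a two-part composition `λ = (l1, n - l1)`,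
written with 0-based indices: `y` maps `{0, …, l1 - 1}` to itself. -/
def YoungTwo {n : ℕ} (l1 : ℕ) (y : Equiv.Perm (Fin n)) : Prop :=
  ∀ i : Fin n, (y i : ℕ) < l1 ↔ (i : ℕ) < l1

/-- `v` is the permutation whose (1-based) one-line notation is
`[l1+1, l1+2, …, l1+k, 1, l1+k+1, …, n, 2, 3, …, l1]`, written with 0-based indices. -/
def IsVk {n : ℕ} (l1 l2 k : ℕ) (v : Equiv.Perm (Fin n)) : Prop :=
  ∀ p : Fin n, (v p : ℕ) =
    if (p : ℕ) < k then l1 + (p : ℕ)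
    else if (p : ℕ) = k then 0
    else if (p : ℕ) ≤ l2 then l1 + (p : ℕ) - 1
    else (p : ℕ) - l2

/-- The set `𝒮_k = {(a,b) : a < b, v_k⁻¹(a) > v_k⁻¹(b), v_k⁻¹(a) ≤ h(v_k⁻¹(b))}`. -/
def SkSet {n : ℕ} (h : Fin n → Fin n) (vk : Equiv.Perm (Fin n)) :
    Finset (Fin n × Fin n) :=
  Finset.univ.filter fun p =>
    p.1 < p.2 ∧ vk⁻¹ p.2 < vk⁻¹ p.1 ∧ vk⁻¹ p.1 ≤ h (vk⁻¹ p.2)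

/-- A polynomial is congruent to its image under exchanging two variables modulo their difference. -/
lemma X_sub_X_dvd_sub_rename_swap {σ R : Type*} [DecidableEq σ] [CommRing R] (i j : σ)
    (F : MvPolynomial σ R) :
    (X i - X j : MvPolynomial σ R) ∣ F - rename (Equiv.swap i j) F := by
  let I : Ideal (MvPolynomial σ R) := Ideal.span {X i - X j}
  have hij : Ideal.Quotient.mk I (X i) = Ideal.Quotient.mk I (X j) :=
    Ideal.Quotient.eq.2 (Ideal.mem_span_singleton_self _)
  have key : Ideal.Quotient.mkₐ R I =
      (Ideal.Quotient.mkₐ R I).comp (rename (Equiv.swap i j)) := by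
    ext x
    simp only [AlgHom.comp_apply, rename_X, Ideal.Quotient.mkₐ_eq_mk]
    rcases eq_or_ne x i with rfl | hi
    · rw [Equiv.swap_apply_left, hij]
    rcases eq_or_ne x j with rfl | hj
    · rw [Equiv.swap_apply_right, hij]
    rw [Equiv.swap_apply_of_ne_of_ne hi hj]
  rw [← Ideal.mem_span_singleton]
  exact Ideal.Quotient.eq.1 (DFunLike.congr_fun key F)

namespace IsVk

variable {n l1 l2 k : ℕ} {v : Equiv.Perm (Fin n)}

lemma apply_lt_iff (hv : IsVk l1 l2 k v) (hl1 : 0 < l1) (hsum : l1 + l2 = n) (hk : k ≤ l2)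
    (p : Fin n) : (v p : ℕ) < l1 ↔ (p : ℕ) = k ∨ l2 < (p : ℕ) := by
  have := hv p
  have := p.isLt
  split_ifs at * <;> omega

lemma inv_apply (hv : IsVk l1 l2 k v) (hl1 : 0 < l1) (hsum : l1 + l2 = n) (hk : k ≤ l2)
    (b : Fin n) : ((v⁻¹ b : Fin n) : ℕ) =
      if (b : ℕ) = 0 then k
      else if (b : ℕ) < l1 then l2 + b
      else if (b : ℕ) < l1 + k then b - l1
      else b - l1 + 1 := by
  obtain ⟨p, rfl⟩ := v.surjective b
  rw [Equiv.Perm.inv_def, Equiv.symm_apply_apply]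
  have := hv p
  have := p.isLt
  split_ifs at * <;> omega

lemma mem_SkSet (hv : IsVk l1 l2 k v) (hl1 : 0 < l1) (hsum : l1 + l2 = n) (hk : k ≤ l2)
    (h : Fin n → Fin n) (a b : Fin n) :
    (a, b) ∈ SkSet h v ↔ (a : ℕ) < l1 ∧ l1 ≤ (b : ℕ) ∧ ((a : ℕ) = 0 → (b : ℕ) < l1 + k) ∧
      v⁻¹ a ≤ h (v⁻¹ b) := by
  have ha := hv.inv_apply hl1 hsum hk a
  have hb := hv.inv_apply hl1 hsum hk b
  have := a.isLt
  have := b.isLt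
  simp only [SkSet, Finset.mem_filter, Finset.mem_univ, true_and, Fin.lt_def, ← and_assoc]
  refine and_congr_left fun _ => ?_
  split_ifs at * <;> omega

lemma youngTwo_mul_inv_iff (hv : IsVk l1 l2 k v) (hl1 : 0 < l1) (hsum : l1 + l2 = n)
    (hk : k ≤ l2) (w : Equiv.Perm (Fin n)) :
    YoungTwo l1 (w * v⁻¹) ↔ ∀ p, (w p : ℕ) < l1 ↔ (p : ℕ) = k ∨ l2 < (p : ℕ) := by
  rw [YoungTwo, ← v.forall_congr_right]
  refine forall_congr' fun p => ?_
  rw [hv.apply_lt_iff hl1 hsum hk, Equiv.Perm.mul_apply, Equiv.Perm.inv_def, Equiv.symm_apply_apply]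

end IsVk

/-- Moving the first small entry from position `m` to position `q` permutes the large entries
with indices in `[l1 + q, l1 + m)` and fixes all the others. -/
lemma IsVk.mul_swap_mul_inv_apply {n l1 l2 m : ℕ} {u v : Equiv.Perm (Fin n)} {q p : Fin n}
    (hu : IsVk l1 l2 m u) (hv : IsVk l1 l2 q v) (hl1 : 0 < l1) (hsum : l1 + l2 = n)
    (hm : m ≤ l2) (hp : (p : ℕ) = m) (hq : (q : ℕ) < m) (a : Fin n) :
    ((u * Equiv.swap p q * v⁻¹) a = a ∧ ¬ (l1 + q ≤ (a : ℕ) ∧ (a : ℕ) < l1 + m)) ∨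
      ((l1 + q ≤ (a : ℕ) ∧ (a : ℕ) < l1 + m) ∧
        l1 + q ≤ ((u * Equiv.swap p q * v⁻¹) a : ℕ) ∧
        ((u * Equiv.swap p q * v⁻¹) a : ℕ) < l1 + m) := by
  obtain ⟨x, rfl⟩ := v.surjective a
  simp only [Equiv.Perm.mul_apply, Equiv.Perm.inv_def, Equiv.symm_apply_apply, Fin.ext_iff]
  have hx := hv x
  have := x.isLt
  rcases eq_or_ne x p with rfl | hxp
  · rw [Equiv.swap_apply_left]
    have := hu q
    split_ifs at * <;> omega
  rcases eq_or_ne x q with rfl | hxq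
  · rw [Equiv.swap_apply_right]
    have := hu p
    split_ifs at * <;> omega
  rw [Equiv.swap_apply_of_ne_of_ne hxp hxq]
  rw [Ne, Fin.ext_iff] at hxp hxq
  have := hu x
  split_ifs at * <;> omega

/-- Theorem 4.8 / `thm.class`: under the stated hypotheses, the class
`f = f_λ^{(k)}` satisfies the GKM conditions for the Hessenberg function `h`. -/
theorem statement0 (n : ℕ) (h : Fin n → Fin n) (hmono : Monotone h) (hgrow : ∀ i, i ≤ h i)
    (l1 l2 k : ℕ) (hl1 : 0 < l1) (hl2 : 0 < l2) (hsum : l1 + l2 = n) (hk : k ≤ l2)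
    (hhn : 1 < l1 → ∀ hkn : k + 1 < n, (h ⟨k + 1, hkn⟩ : ℕ) = n - 1)
    (v : ℕ → Equiv.Perm (Fin n)) (hv : ∀ j ≤ l2, IsVk l1 l2 j (v j))
    (f : Equiv.Perm (Fin n) → MvPolynomial (Fin n) ℂ)
    (hfval : ∀ j, k ≤ j → j ≤ l2 → ∀ y : Equiv.Perm (Fin n), YoungTwo l1 y →
      f (y * v j) = ∏ p ∈ SkSet h (v k), (X (y p.1) - X (y p.2)))
    (hfzero : ∀ w : Equiv.Perm (Fin n),
      (¬ ∃ j, k ≤ j ∧ j ≤ l2 ∧ ∃ y : Equiv.Perm (Fin n), YoungTwo l1 y ∧ w = y * v j) →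
      f w = 0) :
    ∀ w : Equiv.Perm (Fin n), ∀ i j : Fin n, j < i → w i < w j → i ≤ h j →
      (X (w i) - X (w j) : MvPolynomial (Fin n) ℂ) ∣ f w - f (w * Equiv.swap i j) := by
  intro w p q hqp hw hph
  have hlast : 1 < l1 → ∀ x y : Fin n, k + 1 ≤ (x : ℕ) → y ≤ h x := by
    intro hl x y hx
    have hkn : k + 1 < n := by omega
    have h1 : h ⟨k + 1, hkn⟩ ≤ h x := hmono (Fin.le_def.2 hx)
    have h2 := hhn hl hkn
    have := y.isLt
    rw [Fin.le_def] at h1 ⊢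
    omega
  have hval : ∀ m, k ≤ m → m ≤ l2 → ∀ u : Equiv.Perm (Fin n),
      (∀ x, (u x : ℕ) < l1 ↔ (x : ℕ) = m ∨ l2 < (x : ℕ)) →
      f u = ∏ s ∈ SkSet h (v k), (X ((u * (v m)⁻¹) s.1) - X ((u * (v m)⁻¹) s.2)) := by
    intro m hkm hm u hu
    rw [← hfval m hkm hm _ (((hv m hm).youngTwo_mul_inv_iff hl1 hsum hm u).2 hu),
      inv_mul_cancel_right]
  have hzero : ∀ u : Equiv.Perm (Fin n),
      (∀ m, k ≤ m → m ≤ l2 → ¬ ∀ x, (u x : ℕ) < l1 ↔ (x : ℕ) = m ∨ l2 < (x : ℕ)) →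
      f u = 0 := by
    intro u hu
    refine hfzero u ?_
    rintro ⟨m, hkm, hm, y, hy, rfl⟩
    refine hu m hkm hm (((hv m hm).youngTwo_mul_inv_iff hl1 hsum hm _).1 ?_)
    rwa [mul_inv_cancel_right]
  have hdvd : ∀ m, k ≤ m → m ≤ l2 →
      (∀ x, (w x : ℕ) < l1 ↔ (x : ℕ) = m ∨ l2 < (x : ℕ)) →
      (v m p, v m q) ∈ SkSet h (v k) →
      (X (w p) - X (w q) : MvPolynomial (Fin n) ℂ) ∣ f w := by
    intro m hkm hm hwm hmem
    rw [hval m hkm hm w hwm]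
    simpa using Finset.dvd_prod_of_mem
      (fun s : Fin n × Fin n => (X ((w * (v m)⁻¹) s.1) - X ((w * (v m)⁻¹) s.2) :
        MvPolynomial (Fin n) ℂ)) hmem
  have hswap : ∀ x, x ≠ p → x ≠ q → (w * Equiv.swap p q) x = w x := by
    intro x hp hq
    rw [Equiv.Perm.mul_apply, Equiv.swap_apply_of_ne_of_ne hp hq]
  have hswp : (w * Equiv.swap p q) p = w q := by simp
  have hswq : (w * Equiv.swap p q) q = w p := by simp
  rw [Fin.lt_def] at hqp hw
  by_cases htype : (w p : ℕ) < l1 ↔ (w q : ℕ) < l1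
  · have hsame : ∀ x, ((w * Equiv.swap p q) x : ℕ) < l1 ↔ (w x : ℕ) < l1 := by
      intro x
      rcases eq_or_ne x p with rfl | hp
      · rw [hswp, htype]
      rcases eq_or_ne x q with rfl | hq
      · rw [hswq, htype]
      rw [hswap x hp hq]
    by_cases hsupp : ∃ m, k ≤ m ∧ m ≤ l2 ∧ ∀ x, (w x : ℕ) < l1 ↔ (x : ℕ) = m ∨ l2 < (x : ℕ)
    · obtain ⟨m, hkm, hm, hwm⟩ := hsupp
      have heq : f (w * Equiv.swap p q) = rename (Equiv.swap (w p) (w q)) (f w) := by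
        rw [hval m hkm hm w hwm, hval m hkm hm _ fun x => (hsame x).trans (hwm x), map_prod]
        simp [Equiv.mul_swap_eq_swap_mul, mul_assoc]
      rw [heq]
      exact X_sub_X_dvd_sub_rename_swap _ _ _
    · have h0 : f w = 0 := hzero w fun m hkm hm hwm => hsupp ⟨m, hkm, hm, hwm⟩
      have h1 : f (w * Equiv.swap p q) = 0 := hzero _ fun m hkm hm hwm =>
        hsupp ⟨m, hkm, hm, fun x => (hsame x).symm.trans (hwm x)⟩
      simp [h0, h1]
  have hwp : (w p : ℕ) < l1 := by omega
  have hwq : l1 ≤ (w q : ℕ) := by omega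
  by_cases hsupp : ∃ m, k ≤ m ∧ m ≤ l2 ∧ ∀ x, (w x : ℕ) < l1 ↔ (x : ℕ) = m ∨ l2 < (x : ℕ)
  · obtain ⟨m, hkm, hm, hwm⟩ := hsupp
    have hpm := (hwm p).1 hwp
    have hqm : ¬ ((q : ℕ) = m ∨ l2 < (q : ℕ)) := fun hc => by
      have := (hwm q).2 hc
      omega
    by_cases hmain : (p : ℕ) = m ∧ k ≤ (q : ℕ)
    · obtain ⟨hpm, hkq⟩ := hmain
      have hql : (q : ℕ) ≤ l2 := by omega
      have hw' : ∀ x, ((w * Equiv.swap p q) x : ℕ) < l1 ↔ (x : ℕ) = q ∨ l2 < (x : ℕ) := by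
        intro x
        rcases eq_or_ne x p with rfl | hp
        · rw [hswp]; omega
        rcases eq_or_ne x q with rfl | hq
        · rw [hswq]; omega
        rw [hswap x hp hq, hwm]
        rw [Ne, Fin.ext_iff] at hp hq
        omega
      have heq : f (w * Equiv.swap p q) = f w := by
        rw [hval m hkm hm w hwm, hval q hkq hql _ hw']
        let σ : Equiv.Perm (Fin n) := v m * Equiv.swap p q * (v q)⁻¹
        have hσ : ∀ a, _ := (hv m hm).mul_swap_mul_inv_apply (hv q hql) hl1 hsum hm hpm
          (by omega)
        have hVk := hv k hk
        refine Finset.prod_equiv (Equiv.prodCongr σ σ) ?_ ?_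
        · rintro ⟨a, b⟩
          change _ ↔ (σ a, σ b) ∈ _
          rw [hVk.mem_SkSet hl1 hsum hk, hVk.mem_SkSet hl1 hsum hk]
          have hfull : ∀ c d : Fin n, (c : ℕ) < l1 → l1 + (q : ℕ) ≤ (d : ℕ) → (c : ℕ) ≠ 0 →
              (v k)⁻¹ c ≤ h ((v k)⁻¹ d) := by
            intro c d hc hd hc0
            refine hlast (by omega) _ _ ?_
            rw [hVk.inv_apply hl1 hsum hk]
            split_ifs <;> omega
          change ∀ a, (σ a = a ∧ _) ∨ (_ ∧ l1 + (q : ℕ) ≤ (σ a : ℕ) ∧ (σ a : ℕ) < l1 + m) at hσ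
          rcases hσ a with ⟨ha, ha'⟩ | ⟨ha, ha'⟩
          · rw [ha]
            rcases hσ b with ⟨hb, hb'⟩ | ⟨hb, hb'⟩
            · rw [hb]
            · have h1 := hfull a b
              have h2 := hfull a (σ b)
              constructor
              · rintro ⟨h3, h4, h5, h6⟩
                exact ⟨h3, by omega, by omega, h2 h3 (by omega) (by omega)⟩
              · rintro ⟨h3, h4, h5, h6⟩
                exact ⟨h3, by omega, by omega, h1 h3 (by omega) (by omega)⟩
          · constructor
            · rintro ⟨h3, -⟩
              omega
            · rintro ⟨h3, -⟩
              omega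
        · intro s _
          simp [σ]
      rw [heq, sub_self]
      exact dvd_zero _
    · have h0 : f (w * Equiv.swap p q) = 0 := by
        refine hzero _ fun m' hkm' hm' hw' => ?_
        have hq' := (hw' q).1 (by rw [hswq]; exact hwp)
        have hm1 : (p : ℕ) ≠ m := by omega
        have hmp : (⟨m, by omega⟩ : Fin n) ≠ p := fun hc => hm1 (Fin.ext_iff.1 hc).symm
        have hmq : (⟨m, by omega⟩ : Fin n) ≠ q := fun hc => hqm (Or.inl (Fin.ext_iff.1 hc).symm)
        have := hw' ⟨m, by omega⟩
        rw [hswap _ hmp hmq, hwm] at this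
        simp only [true_or, true_iff] at this
        omega
      rw [h0, sub_zero]
      refine hdvd m hkm hm hwm ?_
      have hVk := hv k hk
      have hp' := hv m hm p
      have hq' := hv m hm q
      have hpn := p.isLt
      have hqn := q.isLt
      have e1 := hVk.inv_apply hl1 hsum hk (v m p)
      have e2 := hVk.inv_apply hl1 hsum hk (v m q)
      rw [hVk.mem_SkSet hl1 hsum hk]
      refine ⟨by split_ifs at hp' <;> omega, by split_ifs at hq' <;> omega,
        by split_ifs at hp' hq' <;> omega, ?_⟩
      by_cases hqk : (q : ℕ) < k
      · have e3 : (v k)⁻¹ (v m q) = q := by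
          rw [Fin.ext_iff]
          split_ifs at hq' e2 <;> omega
        rw [e3]
        refine le_trans ?_ hph
        rw [Fin.le_def]
        split_ifs at hp' e1 <;> omega
      · refine hlast (by omega) _ _ ?_
        split_ifs at hq' e2 <;> omega
  · have h0 : f w = 0 := hzero w fun m hkm hm hwm => hsupp ⟨m, hkm, hm, hwm⟩
    have h1 : f (w * Equiv.swap p q) = 0 := by
      refine hzero _ fun m hkm hm hw' => hsupp ?_
      have hq' := (hw' q).1 (by rw [hswq]; exact hwp)
      have hp' : ¬ ((p : ℕ) = m ∨ l2 < (p : ℕ)) := fun hc => by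
        have := (hw' p).2 hc
        rw [hswp] at this
        omega
      refine ⟨p, by omega, by omega, fun x => ?_⟩
      rcases eq_or_ne x p with rfl | hp
      · omega
      rcases eq_or_ne x q with rfl | hq
      · omega
      rw [← hswap x hp hq, hw']
      rw [Ne, Fin.ext_iff] at hp hq
      omega
    simp [h0, h1]
end

section
/- Let h be a Hessenberg function on {1,…,n} and λ = (λ_1, λ_2) a composition of n with two positive parts. Assume h(1) < λ_2 and that the set B = {i : 1 ≤ i ≤ λ_2 − 1 and h(i) ≥ λ_2} is nonempty; if λ_1 > 1, assume in addition that h(λ_2 + 1) = n and h(min B) ≤ λ_2 + 1. Then the family of functions (v_J · f_λ^{(λ_2−1)}), indexed by the λ_1-element subsets J of {1,…,n}, is linearly independent over R, where functions S_n → R are regarded as elements of the free R-module of all functions from S_n to R. -/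
open MvPolynomial Finset

/-- The dot action `(v · f)(w) = v(f(v⁻¹ w))`. -/
noncomputable def dot {n : ℕ} (v : Equiv.Perm (Fin n))
    (f : Equiv.Perm (Fin n) → MvPolynomial (Fin n) ℂ) :
    Equiv.Perm (Fin n) → MvPolynomial (Fin n) ℂ :=
  fun w => rename (⇑v) (f (v⁻¹ * w))

/-- `v` is the shortest left coset representative `v_J`: it lists the elements of `J`
increasingly on the first `l1` (0-based) positions, then the complement increasingly. -/
def IsVJ {n : ℕ} (l1 : ℕ) (J : Finset (Fin n)) (v : Equiv.Perm (Fin n)) : Prop :=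
  (∀ p : Fin n, v p ∈ J ↔ (p : ℕ) < l1) ∧
  (∀ p q : Fin n, p < q → (q : ℕ) < l1 → v p < v q) ∧
  (∀ p q : Fin n, p < q → l1 ≤ (p : ℕ) → v p < v q)

/-- The set `B = {i : 1 ≤ i ≤ l2 - 1, h(i) ≥ l2}` (1-based), written with 0-based indices. -/
def Bset {n : ℕ} (h : Fin n → Fin n) (l2 : ℕ) : Finset (Fin n) :=
  Finset.univ.filter fun p => (p : ℕ) + 2 ≤ l2 ∧ l2 ≤ (h p : ℕ) + 1

/-- The image of `∏ p ∈ S, (X p.1 - X p.2)` under the renaming of variables `u`. -/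
noncomputable def diffProd {n : ℕ} (S : Finset (Fin n × Fin n)) (u : Fin n → Fin n) :
    MvPolynomial (Fin n) ℂ :=
  ∏ p ∈ S, (X (u p.1) - X (u p.2))

lemma rename_diffProd {n : ℕ} (S : Finset (Fin n × Fin n)) (u r : Fin n → Fin n) :
    rename r (diffProd S u) = diffProd S (r ∘ u) := by
  simp [diffProd, map_prod]

lemma diffProd_eq_zero_iff {n : ℕ} (S : Finset (Fin n × Fin n)) (u : Fin n → Fin n) :
    diffProd S u = 0 ↔ ∃ p ∈ S, u p.1 = u p.2 := by
  simp only [diffProd, Finset.prod_eq_zero_iff, sub_eq_zero, X_injective.eq_iff]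

/-- `u` maps `{0, …, l1 - 1}` onto `J`. -/
def MapsInitial {n : ℕ} (l1 : ℕ) (u : Equiv.Perm (Fin n)) (J : Finset (Fin n)) : Prop :=
  ∀ i : Fin n, u i ∈ J ↔ (i : ℕ) < l1

lemma MapsInitial.unique {n l1 : ℕ} {u : Equiv.Perm (Fin n)} {J K : Finset (Fin n)}
    (hJ : MapsInitial l1 u J) (hK : MapsInitial l1 u K) : J = K := by
  ext x
  have h1 := hJ (u.symm x)
  have h2 := hK (u.symm x)
  rw [Equiv.apply_symm_apply] at h1 h2
  rw [h1, h2]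

lemma MapsInitial.mul_young {n l1 : ℕ} {u y : Equiv.Perm (Fin n)} {J : Finset (Fin n)}
    (hJ : MapsInitial l1 u J) (hy : YoungTwo l1 y) : MapsInitial l1 (u * y) J := fun i => by
  rw [Equiv.Perm.mul_apply, hJ, hy]

lemma MapsInitial.young_inv_mul {n l1 : ℕ} {u g : Equiv.Perm (Fin n)} {J : Finset (Fin n)}
    (hu : MapsInitial l1 u J) (hg : MapsInitial l1 g J) : YoungTwo l1 (u⁻¹ * g) := fun i => by
  rw [← hu, ← Equiv.Perm.mul_apply, mul_inv_cancel_left, hg]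

lemma exists_mapsInitial {n l1 : ℕ} (u : Equiv.Perm (Fin n)) :
    ∃ J : Finset (Fin n), MapsInitial l1 u J :=
  ⟨(univ.filter fun i : Fin n => (i : ℕ) < l1).map u.toEmbedding, fun i => by simp⟩

lemma MapsInitial.card_eq {n l1 : ℕ} {u g : Equiv.Perm (Fin n)} {J K : Finset (Fin n)}
    (hJ : MapsInitial l1 u J) (hK : MapsInitial l1 g K) : J.card = K.card := by
  refine Finset.card_equiv (u.symm.trans g) fun x => ?_
  have h1 := hJ (u.symm x)
  rw [Equiv.apply_symm_apply] at h1
  rw [h1, Equiv.trans_apply, hK]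

lemma dot_eq_diffProd {n l1 : ℕ} {S : Finset (Fin n × Fin n)} {u g vj : Equiv.Perm (Fin n)}
    {J : Finset (Fin n)} {f : Equiv.Perm (Fin n) → MvPolynomial (Fin n) ℂ}
    (hf : ∀ y : Equiv.Perm (Fin n), YoungTwo l1 y → f (y * vj) = diffProd S y)
    (hu : MapsInitial l1 u J) (hg : MapsInitial l1 g J) :
    dot u f (g * vj) = diffProd S g := by
  rw [dot, ← mul_assoc, hf _ (hu.young_inv_mul hg), rename_diffProd]
  congr 1
  ext i
  simp

/-- The permutation `v_{k+1}` is obtained from `v_k` by exchanging the first and last values. -/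
lemma IsVk.eq_swap_mul {l l2 k : ℕ} (hk : k + 1 = l2) {vk vl : Equiv.Perm (Fin (l + l2 + 1))}
    (hvk : IsVk (l + 1) l2 k vk) (hvl : IsVk (l + 1) l2 l2 vl) :
    vk = Equiv.swap 0 (Fin.last _) * vl := by
  ext p
  have h1 := hvk p
  have h2 := hvl p
  have hp := p.isLt
  rw [Equiv.Perm.mul_apply, Equiv.swap_apply_def]
  split_ifs with h3 h4
  · have : (vl p : ℕ) = 0 := by rw [h3]; rfl
    simp only [Fin.val_last]
    split_ifs at h1 h2 <;> omega
  · have : (vl p : ℕ) = l + l2 := by rw [h4]; rfl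
    simp only [Fin.val_zero]
    split_ifs at h1 h2 <;> omega
  · have h5 : (vl p : ℕ) ≠ 0 := fun h => h3 (Fin.ext h)
    have h6 : (vl p : ℕ) ≠ l + l2 := fun h => h4 (Fin.ext h)
    split_ifs at h1 h2 <;> omega

lemma diffProd_det_ne_zero {n : ℕ} {S : Finset (Fin n × Fin n)} (hS : ∀ p ∈ S, p.1 < p.2)
    (g : Equiv.Perm (Fin n)) {o a b e : Fin n} (hoa : o < a) (hab : a < b) (hbe : b < e)
    (hob : (o, b) ∈ S) (hnoa : (o, a) ∉ S) (hnbe : (b, e) ∉ S) :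
    diffProd S g * diffProd S ⇑(g * Equiv.swap a b * Equiv.swap o e)
      - diffProd S ⇑(g * Equiv.swap o e) * diffProd S ⇑(g * Equiv.swap a b) ≠ 0 := by
  intro h0
  have key := congrArg (rename (fun x => if x = g e then g b else x)) h0
  have hz : diffProd S ((fun x => if x = g e then g b else x) ∘ ⇑(g * Equiv.swap o e)) = 0 := by
    rw [diffProd_eq_zero_iff]
    refine ⟨(o, b), hob, ?_⟩
    have : Equiv.swap o e b = b :=
      Equiv.swap_apply_of_ne_of_ne (hoa.trans hab).ne' hbe.ne
    simp [this]
  simp only [map_sub, map_mul, rename_diffProd, hz, zero_mul, sub_zero, map_zero, mul_eq_zero,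
    diffProd_eq_zero_iff] at key
  have hcollapse : ∀ x y : Fin n, x ≠ y →
      (if g x = g e then g b else g x) = (if g y = g e then g b else g y) →
      (x = e ∧ y = b) ∨ (x = b ∧ y = e) := by
    intro x y hxy h
    simp only [g.injective.eq_iff] at h
    split_ifs at h with h1 h2 h2
    · exact absurd (h1.trans h2.symm) hxy
    · exact Or.inl ⟨h1, (g.injective h).symm⟩
    · exact Or.inr ⟨g.injective h, h2⟩
    · exact absurd (g.injective h) hxy
  rcases key with ⟨⟨x, y⟩, hp, h⟩ | ⟨⟨x, y⟩, hp, h⟩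
  · have hlt : x < y := hS _ hp
    rcases hcollapse x y hlt.ne h with ⟨rfl, rfl⟩ | ⟨rfl, rfl⟩
    · exact absurd hlt hbe.not_gt
    · exact hnbe hp
  · have hlt : x < y := hS _ hp
    have hsb : Equiv.swap o e (Equiv.swap a b b) = a := by
      rw [Equiv.swap_apply_right, Equiv.swap_apply_of_ne_of_ne hoa.ne' (hab.trans hbe).ne]
    have hse : Equiv.swap o e (Equiv.swap a b e) = o := by
      rw [Equiv.swap_apply_of_ne_of_ne (hab.trans hbe).ne' hbe.ne', Equiv.swap_apply_right]
    have hinv : ∀ z c : Fin n, Equiv.swap a b (Equiv.swap o e z) = c →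
        z = Equiv.swap o e (Equiv.swap a b c) := by
      rintro z _ rfl
      simp
    rcases hcollapse _ _ (fun h' => hlt.ne ((Equiv.injective _) ((Equiv.injective _) h'))) h
      with ⟨h1, h2⟩ | ⟨h1, h2⟩
    · have hx := (hinv _ _ h1).trans hse
      have hy := (hinv _ _ h2).trans hsb
      subst hx hy
      exact hnoa hp
    · have hx := (hinv _ _ h1).trans hsb
      have hy := (hinv _ _ h2).trans hse
      subst hx hy
      exact absurd hlt hoa.not_gt

/-- Theorem 5.1 / `theorem: orbit independence`, linear independence part:
the `S_n`-orbit `{v_J · f_λ^{(λ₂-1)}}` is linearly independent over `R = ℂ[t_1,…,t_n]`. -/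
theorem statement1 (n : ℕ) (h : Fin n → Fin n) (hmono : Monotone h) (hgrow : ∀ i, i ≤ h i)
    (l1 l2 k : ℕ) (hl1 : 0 < l1) (hl2 : 0 < l2) (hsum : l1 + l2 = n) (hk : k + 1 = l2)
    (hh1 : ∀ h0 : 0 < n, (h ⟨0, h0⟩ : ℕ) + 1 < l2)
    (hBne : (Bset h l2).Nonempty)
    (hhn : 1 < l1 → ∀ hq : l2 < n, (h ⟨l2, hq⟩ : ℕ) = n - 1)
    (hminB : 1 < l1 → (h ((Bset h l2).min' hBne) : ℕ) + 1 ≤ l2 + 1)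
    (v : ℕ → Equiv.Perm (Fin n)) (hv : ∀ j ≤ l2, IsVk l1 l2 j (v j))
    (f : Equiv.Perm (Fin n) → MvPolynomial (Fin n) ℂ)
    (hfval : ∀ j, k ≤ j → j ≤ l2 → ∀ y : Equiv.Perm (Fin n), YoungTwo l1 y →
      f (y * v j) = ∏ p ∈ SkSet h (v k), (X (y p.1) - X (y p.2)))
    (hfzero : ∀ w : Equiv.Perm (Fin n),
      (¬ ∃ j, k ≤ j ∧ j ≤ l2 ∧ ∃ y : Equiv.Perm (Fin n), YoungTwo l1 y ∧ w = y * v j) →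
      f w = 0)
    (vJ : Finset (Fin n) → Equiv.Perm (Fin n))
    (hvJ : ∀ J : Finset (Fin n), J.card = l1 → IsVJ l1 J (vJ J)) :
    LinearIndependent (MvPolynomial (Fin n) ℂ)
      (fun J : {J : Finset (Fin n) // J.card = l1} => dot (vJ J.1) f) := by
  obtain ⟨l, rfl⟩ : ∃ l, l1 = l + 1 := ⟨l1 - 1, by omega⟩
  obtain rfl : n = l + l2 + 1 := by omega
  have hvk := hv k (by omega)
  set S := SkSet h (v k) with hSdef
  set e : Fin (l + l2 + 1) := Fin.last _ with he
  have hval : ∀ j, k ≤ j → j ≤ l2 → ∀ y : Equiv.Perm (Fin (l + l2 + 1)), YoungTwo (l + 1) y →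
      f (y * v j) = diffProd S y := hfval
  have hMJ : ∀ J : Finset (Fin (l + l2 + 1)), J.card = l + 1 → MapsInitial (l + 1) (vJ J) J :=
    fun J hJ => (hvJ J hJ).1
  have hvkl : v k = Equiv.swap 0 e * v l2 := hvk.eq_swap_mul hk (hv l2 le_rfl)
  rw [Fintype.linearIndependent_iff]
  intro c hc
  have hrel : ∀ (g : Equiv.Perm (Fin (l + l2 + 1)))
      (J K : {J : Finset (Fin (l + l2 + 1)) // J.card = l + 1}),
      MapsInitial (l + 1) g J.1 → MapsInitial (l + 1) (g * Equiv.swap 0 e) K.1 →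
      c J * diffProd S g + c K * diffProd S ⇑(g * Equiv.swap 0 e) = 0 := by
    intro g J K hJ hK
    have hw : g * v k = g * Equiv.swap 0 e * v l2 := by rw [hvkl, mul_assoc]
    have hJK : J ≠ K := by
      rintro rfl
      have h1 := (hJ e).1 (by simpa using (hK 0).2 (by simp))
      simp only [he, Fin.val_last] at h1
      omega
    have hsum0 := congrFun hc (g * v k)
    simp only [Finset.sum_apply, Pi.smul_apply, smul_eq_mul, Pi.zero_apply] at hsum0
    rw [Fintype.sum_eq_add J K hJK] at hsum0
    · rw [dot_eq_diffProd (hval k le_rfl (by omega)) (hMJ _ J.2) hJ, hw,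
        dot_eq_diffProd (hval l2 (by omega) le_rfl) (hMJ _ K.2) hK] at hsum0
      exact hsum0
    · rintro L ⟨hLJ, hLK⟩
      rw [dot, hfzero, map_zero, mul_zero]
      rintro ⟨j, hkj, hjl, y, hy, hyw⟩
      have hL := (hMJ _ L.2).mul_young hy
      have hyw' : g * v k = vJ L.1 * y * v j := by
        rw [mul_assoc, ← hyw, mul_inv_cancel_left]
      obtain rfl | rfl : j = k ∨ j = l2 := by omega
      · rw [← mul_right_cancel hyw'] at hL
        exact hLJ (Subtype.ext (hL.unique hJ))
      · rw [hw] at hyw'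
        rw [← mul_right_cancel hyw'] at hL
        exact hLK (Subtype.ext (hL.unique hK))
  intro J
  obtain ⟨m, hm⟩ := hBne
  simp only [Bset, mem_filter, mem_univ, true_and] at hm
  have hh0 : (h 0 : ℕ) + 1 < l2 := hh1 (by omega)
  have hm0 : 0 < (m : ℕ) := by
    refine Nat.pos_of_ne_zero fun h0 => ?_
    have : m = 0 := Fin.ext h0
    simp only [this] at hm
    omega
  let a : Fin (l + l2 + 1) := ⟨l + 1, by omega⟩
  let b : Fin (l + l2 + 1) := ⟨l + 1 + m, by omega⟩
  have hinv : ∀ p q : Fin (l + l2 + 1), v k p = q → (v k)⁻¹ q = p := by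
    rintro p _ rfl
    simp
  have hi0 : (v k)⁻¹ 0 = ⟨k, by omega⟩ := hinv _ _ (Fin.ext (by simp [hvk _]))
  have hia : (v k)⁻¹ a = 0 := hinv _ _ (Fin.ext (by
    rw [hvk, if_pos (by simp only [Fin.val_zero]; omega)]; simp [a]))
  have hib : (v k)⁻¹ b = m := hinv _ _ (Fin.ext (by rw [hvk, if_pos (by omega)]))
  have hie : (v k)⁻¹ e = ⟨l2, by omega⟩ := hinv _ _ (Fin.ext (by
    rw [hvk, if_neg (by simp only; omega), if_neg (by simp only; omega),
      if_pos (by simp)]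
    simp only [he, Fin.val_last]
    omega))
  have hoa : 0 < a := by simp [a, Fin.lt_def]
  have hab : a < b := Fin.lt_def.2 (Nat.lt_add_of_pos_right hm0)
  have hbe : b < e := by rw [Fin.lt_def, he, Fin.val_last]; simp only [b]; omega
  have hS : ∀ p ∈ S, p.1 < p.2 := fun p hp => by
    simp only [hSdef, SkSet, mem_filter] at hp
    exact hp.2.1
  have hob : (0, b) ∈ S := by
    simp only [hSdef, SkSet, mem_filter, mem_univ, true_and, hi0, hib]
    refine ⟨hoa.trans hab, ?_, ?_⟩
    · simp only [Fin.lt_def]; omega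
    · simp only [Fin.le_def]; omega
  have hnoa : (0, a) ∉ S := by
    simp only [hSdef, SkSet, mem_filter, mem_univ, true_and, hi0, hia, Fin.le_def]
    omega
  have hnbe : (b, e) ∉ S := by
    simp only [hSdef, SkSet, mem_filter, mem_univ, true_and, hib, hie, Fin.lt_def]
    omega
  have hdet := diffProd_det_ne_zero hS (vJ J.1) hoa hab hbe hob hnoa hnbe
  have hJ := hMJ J.1 J.2
  obtain ⟨K, hK⟩ := exists_mapsInitial (l1 := l + 1) (vJ J.1 * Equiv.swap 0 e)
  have hKcard : K.card = l + 1 := (hK.card_eq hJ).trans J.2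
  have hyoung : YoungTwo (l + 1) (Equiv.swap a b) := by
    intro i
    rw [Equiv.swap_apply_def]
    split_ifs with h1 h1
    · simp only [h1, a, b]; omega
    · simp only [h1, a, b]; omega
    · rfl
  have hcomm : vJ J.1 * Equiv.swap a b * Equiv.swap 0 e
      = vJ J.1 * Equiv.swap 0 e * Equiv.swap a b := by
    rw [mul_assoc, mul_assoc]
    congr 1
    refine Equiv.Perm.Disjoint.commute fun x => ?_
    by_cases hx : x = a ∨ x = b
    · right
      rcases hx with rfl | rfl
      · exact Equiv.swap_apply_of_ne_of_ne hoa.ne' (hab.trans hbe).ne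
      · exact Equiv.swap_apply_of_ne_of_ne (hoa.trans hab).ne' hbe.ne
    · left
      exact Equiv.swap_apply_of_ne_of_ne (fun h' => hx (Or.inl h')) (fun h' => hx (Or.inr h'))
  have r1 := hrel (vJ J.1) J ⟨K, hKcard⟩ hJ hK
  have r2 := hrel (vJ J.1 * Equiv.swap a b) J ⟨K, hKcard⟩ (hJ.mul_young hyoung)
    (hcomm ▸ hK.mul_young hyoung)
  refine (mul_eq_zero.1 ?_).resolve_right hdet
  linear_combination diffProd S ⇑(vJ J.1 * Equiv.swap a b * Equiv.swap 0 e) * r1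
    - diffProd S ⇑(vJ J.1 * Equiv.swap 0 e) * r2
end

section
/- Let h be a Hessenberg function on {1,…,n} and λ = (λ_1, λ_2) a composition of n with two positive parts, and let 0 ≤ k ≤ λ_2; if λ_1 = 1, assume additionally that k ≥ 1. Then the stabilizer of f_λ^{(k)} under the dot action is exactly the Young subgroup S_λ, i.e., {v ∈ S_n : v · f_λ^{(k)} = f_λ^{(k)}} = S_λ. -/
open MvPolynomial Finset

theorem YoungTwo.inv {n l1 : ℕ} {y : Equiv.Perm (Fin n)} (hy : YoungTwo l1 y) :
    YoungTwo l1 y⁻¹ := fun i => by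
  simpa using (hy (y⁻¹ i)).symm

theorem YoungTwo.mul {n l1 : ℕ} {y z : Equiv.Perm (Fin n)} (hy : YoungTwo l1 y)
    (hz : YoungTwo l1 z) : YoungTwo l1 (y * z) := fun i =>
  (hy (z i)).trans (hz i)

theorem youngTwo_swap {n l1 : ℕ} {a b : Fin n} (hab : (a : ℕ) < l1 ↔ (b : ℕ) < l1) :
    YoungTwo l1 (Equiv.swap a b) := fun i => by
  rw [Equiv.swap_apply_def]
  split_ifs with h1 h2
  · rw [h1, hab]
  · rw [h2, hab]
  · rfl

/-- A permutation mapping the first block into itself preserves both blocks. -/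
theorem youngTwo_of_mapsTo {n l1 : ℕ} {u : Equiv.Perm (Fin n)}
    (hu : ∀ a : Fin n, (a : ℕ) < l1 → (u a : ℕ) < l1) : YoungTwo l1 u := fun i =>
  ⟨fun hi => by
    simpa using Equiv.Perm.perm_symm_on_of_perm_on_finite (p := fun a : Fin n => (a : ℕ) < l1)
      (f := u) hu hi, hu i⟩

theorem prod_X_sub_X_ne_zero {n : ℕ} (h : Fin n → Fin n) (w y : Equiv.Perm (Fin n)) :
    ∏ p ∈ SkSet h w, (X (y p.1) - X (y p.2) : MvPolynomial (Fin n) ℂ) ≠ 0 := by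
  refine Finset.prod_ne_zero_iff.2 fun p hp => ?_
  have hlt : p.1 < p.2 := (Finset.mem_filter.1 hp).2.1
  rw [sub_ne_zero, Ne, X_injective.eq_iff, y.injective.eq_iff]
  exact hlt.ne

/-- Lemma 4.14 / `lemma: stabilizer is Slambda`: the stabilizer of
`f_λ^{(k)}` under the dot action is exactly the Young subgroup `S_λ`. -/
theorem statement2 (n : ℕ) (h : Fin n → Fin n) (hmono : Monotone h) (hgrow : ∀ i, i ≤ h i)
    (l1 l2 k : ℕ) (hl1 : 0 < l1) (hl2 : 0 < l2) (hsum : l1 + l2 = n) (hk : k ≤ l2)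
    (hk1 : l1 = 1 → 1 ≤ k)
    (v : ℕ → Equiv.Perm (Fin n)) (hv : ∀ j ≤ l2, IsVk l1 l2 j (v j))
    (f : Equiv.Perm (Fin n) → MvPolynomial (Fin n) ℂ)
    (hfval : ∀ j, k ≤ j → j ≤ l2 → ∀ y : Equiv.Perm (Fin n), YoungTwo l1 y →
      f (y * v j) = ∏ p ∈ SkSet h (v k), (X (y p.1) - X (y p.2)))
    (hfzero : ∀ w : Equiv.Perm (Fin n),
      (¬ ∃ j, k ≤ j ∧ j ≤ l2 ∧ ∃ y : Equiv.Perm (Fin n), YoungTwo l1 y ∧ w = y * v j) →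
      f w = 0) :
    ∀ u : Equiv.Perm (Fin n), dot u f = f ↔ YoungTwo l1 u := by
  intro u
  constructor
  · intro hu
    have key : ∀ y, YoungTwo l1 y → ∃ j, k ≤ j ∧ j ≤ l2 ∧
        ∃ y' : Equiv.Perm (Fin n), YoungTwo l1 y' ∧ u * (y * v k) = y' * v j := by
      intro y hy
      by_contra hcon
      have h0 := (congrFun hu (u * (y * v k))).trans (hfzero _ hcon)
      rw [dot, inv_mul_cancel_left, ← map_zero (rename u)] at h0
      have h1 := rename_injective _ u.injective h0
      rw [hfval k le_rfl hk y hy] at h1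
      exact prod_X_sub_X_ne_zero h (v k) y h1
    refine youngTwo_of_mapsTo fun a ha => ?_
    obtain rfl | hl : l1 = 1 ∨ 2 ≤ l1 := by omega
    · have hk0 := hk1 rfl
      by_contra hua
      have h0n : 0 < n := by omega
      obtain ⟨b, hb⟩ := u.surjective ⟨0, h0n⟩
      have hb0 : ¬ (b : ℕ) < 1 := fun hb0 => by
        have hba : b = a := Fin.ext (by omega)
        rw [hba] at hb
        simp [hb] at hua
      have hval : ∀ j, 1 ≤ j → j ≤ l2 → v j ⟨0, h0n⟩ = ⟨1, by omega⟩ := fun j hj hj' => by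
        apply Fin.ext
        rw [hv j hj' ⟨0, h0n⟩]
        simp; omega
      obtain ⟨j, hj, hj', y', hy', he⟩ := key (Equiv.swap ⟨1, by omega⟩ b)
        (youngTwo_swap (by simpa using hb0))
      have he' := congrArg (fun w => w ⟨0, h0n⟩) he
      simp only [Equiv.Perm.mul_apply, hval k hk0 hk, hval j (hk0.trans hj) hj',
        Equiv.swap_apply_left, hb] at he'
      have := hy' ⟨1, by omega⟩
      rw [← he'] at this
      simp at this
    · have hval : ∀ j ≤ l2, v j ⟨n - 1, by omega⟩ = ⟨l1 - 1, by omega⟩ := fun j hj => by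
        apply Fin.ext
        rw [hv j hj ⟨n - 1, by omega⟩]
        simp only
        split_ifs <;> omega
      obtain ⟨j, hj, hj', y', hy', he⟩ := key (Equiv.swap ⟨l1 - 1, by omega⟩ a)
        (youngTwo_swap (by simp [ha]; omega))
      have he' := congrArg (fun w => w ⟨n - 1, by omega⟩) he
      simp only [Equiv.Perm.mul_apply, hval k hk, hval j hj', Equiv.swap_apply_left] at he'
      rw [he', hy']
      simp only
      omega
  · intro hu
    funext w
    by_cases hw : ∃ j, k ≤ j ∧ j ≤ l2 ∧ ∃ y : Equiv.Perm (Fin n), YoungTwo l1 y ∧ w = y * v j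
    · obtain ⟨j, hj, hj', y, hy, rfl⟩ := hw
      rw [dot, ← mul_assoc, hfval j hj hj' _ (hu.inv.mul hy), hfval j hj hj' y hy]
      simp
    · rw [hfzero w hw, dot, hfzero, map_zero]
      rintro ⟨j, hj, hj', y, hy, he⟩
      exact hw ⟨j, hj, hj', u * y, hu.mul hy, by rw [mul_assoc, ← he, mul_inv_cancel_left]⟩
end

section
/- Let λ = (1, n−1) and let h be a Hessenberg function on {1,…,n} that is connected (h(i) > i for all 1 ≤ i ≤ n−1), satisfies h(1) < n−1, and satisfies |{i : 1 ≤ i ≤ n−2, h(i) ≥ n−1}| = |{i : 1 ≤ i ≤ n−1, h(i) = n}| ≥ 2. For 0 ≤ i ≤ n−1 let u_i ∈ S_n be the permutation with one-line notation [2, 3, …, i+1, 1, i+2, …, n] (so u_0 is the identity), and set f_i = u_i⁻¹ · f_λ^{(n−2)} and g_i = u_i⁻¹ · f_λ^{(n−1)}. Then the 2n functions f_0, f_1, …, f_{n−1}, g_0, g_1, …, g_{n−1} are linearly independent over R, where functions S_n → R are regarded as elements of the free R-module of all functions from S_n to R. -/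
open MvPolynomial Finset

/-- The product of the linear forms `t_i - t_{w(p)}` over the positions `p ∈ S`. -/
noncomputable def positionProd {σ R : Type*} [CommRing R] (S : Finset σ) (w : Equiv.Perm σ)
    (i : σ) : MvPolynomial σ R :=
  ∏ p ∈ S, (X i - X (w p))

section PositionProd

variable {σ R : Type*} [CommRing R]

theorem X_sub_X_ne_zero [Nontrivial R] {i j : σ} (hij : i ≠ j) :
    (X i - X j : MvPolynomial σ R) ≠ 0 :=
  sub_ne_zero.mpr fun h => hij (X_injective h)

theorem positionProd_ne_zero [IsDomain R] {S : Finset σ} {w : Equiv.Perm σ} {m : σ}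
    (hm : m ∉ S) : (positionProd S w (w m) : MvPolynomial σ R) ≠ 0 :=
  Finset.prod_ne_zero_iff.mpr fun _ hp =>
    X_sub_X_ne_zero fun h => hm (w.injective h ▸ hp)

variable [DecidableEq σ]

theorem positionProd_eq_mul_erase {S : Finset σ} (w : Equiv.Perm σ) (i : σ) {q : σ}
    (hq : q ∈ S) :
    (positionProd S w i : MvPolynomial σ R) =
      (X i - X (w q)) * positionProd (S.erase q) w i :=
  (Finset.mul_prod_erase S _ hq).symm

theorem positionProd_mul_swap_of_notMem {S : Finset σ} (w : Equiv.Perm σ) (i : σ) {a q : σ}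
    (ha : a ∉ S) (hq : q ∈ S) :
    (positionProd S (w * Equiv.swap a q) i : MvPolynomial σ R) =
      (X i - X (w a)) * positionProd (S.erase q) w i := by
  rw [positionProd_eq_mul_erase _ i hq, Equiv.Perm.mul_apply, Equiv.swap_apply_right]
  congr 1
  refine Finset.prod_congr rfl fun p hp => ?_
  rw [Finset.mem_erase] at hp
  rw [Equiv.Perm.mul_apply, Equiv.swap_apply_of_ne_of_ne (ne_of_mem_of_not_mem hp.2 ha) hp.1]

theorem positionProd_mul_swap_of_mem {S : Finset σ} (w : Equiv.Perm σ) (i : σ) {p q : σ}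
    (hp : p ∈ S) (hq : q ∈ S) :
    (positionProd S (w * Equiv.swap p q) i : MvPolynomial σ R) = positionProd S w i := by
  refine Finset.prod_equiv (Equiv.swap p q) (fun x => ?_) fun x _ => rfl
  rcases eq_or_ne x p with rfl | hxp
  · simp [hp, hq]
  rcases eq_or_ne x q with rfl | hxq
  · simp [hp, hq]
  rw [Equiv.swap_apply_of_ne_of_ne hxp hxq]

/-- Functions on permutations given by position products, `F i` supported where `i` sits at
position `m` or `l` and `G i` where `i` sits at position `l`, are linearly independent as soon
as `A` meets both `B` and its complement and misses a third position `o`. -/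
theorem linearIndependent_positionProd [Fintype σ] [IsDomain R] {A B : Finset σ}
    {m l o p q : σ} (hml : m ≠ l) (hmA : m ∉ A) (hlA : l ∉ A) (hlB : l ∉ B)
    (hpA : p ∈ A) (hpB : p ∉ B) (hqA : q ∈ A) (hqB : q ∈ B)
    (hoA : o ∉ A) (hom : o ≠ m) (hol : o ≠ l)
    (F G : σ → Equiv.Perm σ → MvPolynomial σ R)
    (hF : ∀ i w, F i w = if i = w m ∨ i = w l then positionProd A w i else 0)
    (hG : ∀ i w, G i w = if i = w l then positionProd B w i else 0) :
    LinearIndependent (MvPolynomial σ R) (Sum.elim F G) := by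
  have hqm : q ≠ m := fun h => hmA (h ▸ hqA)
  have hql : q ≠ l := fun h => hlA (h ▸ hqA)
  have hpm : p ≠ m := fun h => hmA (h ▸ hpA)
  have hpl : p ≠ l := fun h => hlA (h ▸ hpA)
  have hpq : p ≠ q := fun h => hpB (h ▸ hqB)
  have hoq : o ≠ q := fun h => hoA (h ▸ hqA)
  rw [Fintype.linearIndependent_iff]
  intro c hc
  have key (w : Equiv.Perm σ) :
      c (Sum.inl (w m)) * positionProd A w (w m) + c (Sum.inl (w l)) * positionProd A w (w l)
        + c (Sum.inr (w l)) * positionProd B w (w l) = 0 := by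
    have hw := congrFun hc w
    have hFsum : ∑ i, c (Sum.inl i) * F i w =
        c (Sum.inl (w m)) * positionProd A w (w m)
          + c (Sum.inl (w l)) * positionProd A w (w l) := by
      rw [← Finset.sum_pair (w.injective.ne hml)
        (f := fun i => c (Sum.inl i) * positionProd A w i), ← Finset.sum_subset
        (Finset.subset_univ {w m, w l})]
      · refine Finset.sum_congr rfl fun i hi => ?_
        rw [hF, if_pos (by simpa using hi)]
      · intro i _ hi
        rw [hF, if_neg (by simpa using hi), mul_zero]
    simp only [Fintype.sum_sum_type, Sum.elim_inl, Sum.elim_inr,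
      Finset.sum_apply, Pi.smul_apply, smul_eq_mul, Pi.zero_apply] at hw
    rw [hFsum] at hw
    simpa [hG] using hw
  have hb (j : σ) : c (Sum.inr j) = 0 := by
    obtain ⟨w, rfl⟩ : ∃ w : Equiv.Perm σ, w l = j := ⟨Equiv.swap l j, Equiv.swap_apply_left l j⟩
    have h1 := key w
    have h2 := key (w * Equiv.swap p q)
    simp only [Equiv.Perm.mul_apply, Equiv.swap_apply_of_ne_of_ne hpm.symm hqm.symm,
      Equiv.swap_apply_of_ne_of_ne hpl.symm hql.symm] at h2
    rw [positionProd_mul_swap_of_mem _ _ hpA hqA, positionProd_mul_swap_of_mem _ _ hpA hqA,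
      positionProd_mul_swap_of_notMem _ _ hpB hqB] at h2
    rw [positionProd_eq_mul_erase (S := B) _ _ hqB] at h1
    have h3 : c (Sum.inr (w l)) *
        ((X (w p) - X (w q)) * positionProd (B.erase q) w (w l)) = 0 := by
      linear_combination h1 - h2
    exact (mul_eq_zero.mp h3).resolve_right (mul_ne_zero (X_sub_X_ne_zero (w.injective.ne hpq))
      (positionProd_ne_zero fun h => hlB (Finset.mem_of_mem_erase h)))
  have ha (i : σ) : c (Sum.inl i) = 0 := by
    obtain ⟨w, rfl⟩ : ∃ w : Equiv.Perm σ, w m = i := ⟨Equiv.swap m i, Equiv.swap_apply_left m i⟩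
    have h1 := key w
    have h2 := key (w * Equiv.swap o q)
    simp only [Equiv.Perm.mul_apply, Equiv.swap_apply_of_ne_of_ne hom.symm hqm.symm,
      Equiv.swap_apply_of_ne_of_ne hol.symm hql.symm] at h2
    rw [hb, positionProd_mul_swap_of_notMem _ _ hoA hqA,
      positionProd_mul_swap_of_notMem _ _ hoA hqA] at h2
    rw [hb, positionProd_eq_mul_erase _ _ hqA, positionProd_eq_mul_erase _ _ hqA] at h1
    have h3 : c (Sum.inl (w m)) * ((X (w m) - X (w l)) * (X (w q) - X (w o)) *
        positionProd (A.erase q) w (w m)) = 0 := by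
      linear_combination (X (w l) - X (w o)) * h1 - (X (w l) - X (w q)) * h2
    exact (mul_eq_zero.mp h3).resolve_right (mul_ne_zero (mul_ne_zero
      (X_sub_X_ne_zero (w.injective.ne hml)) (X_sub_X_ne_zero (w.injective.ne hoq.symm)))
      (positionProd_ne_zero fun h => hmA (Finset.mem_of_mem_erase h)))
  rintro (i | j)
  exacts [ha i, hb j]

end PositionProd

section YoungOne

variable {n l2 k : ℕ} {v : Equiv.Perm (Fin n)}

theorem IsVk.val_apply_eq_zero_iff (hv : IsVk 1 l2 k v) (hsum : 1 + l2 = n) (p : Fin n) :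
    (v p : ℕ) = 0 ↔ (p : ℕ) = k := by
  have := hv p
  split_ifs at this <;> omega

theorem IsVk.val_apply_of_lt (hv : IsVk 1 l2 k v) {p : Fin n} (hp : (p : ℕ) < k) :
    (v p : ℕ) = 1 + (p : ℕ) := by
  rw [hv p, if_pos hp]

theorem IsVk.val_apply_of_gt (hv : IsVk 1 l2 k v) (hsum : 1 + l2 = n) {p : Fin n}
    (hp : k < (p : ℕ)) : (v p : ℕ) = p := by
  have := hv p
  split_ifs at this <;> omega

/-- A permutation lies in the coset `S_λ v_k`, `λ = (1, n - 1)`, iff it sends `k` to the first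
letter. -/
theorem youngTwo_mul_inv_iff (hv : IsVk 1 l2 k v) (hsum : 1 + l2 = n) (kk : Fin n)
    (hk : (kk : ℕ) = k) (w : Equiv.Perm (Fin n)) :
    YoungTwo 1 (w * v⁻¹) ↔ (w kk : ℕ) = 0 := by
  have hvk : (v kk : ℕ) = 0 := (hv.val_apply_eq_zero_iff hsum kk).mpr hk
  constructor
  · intro hy
    have := (hy (v kk)).mpr (by omega)
    simp only [Equiv.Perm.mul_apply, Equiv.Perm.inv_def, Equiv.symm_apply_apply] at this
    omega
  · intro hw i
    obtain ⟨p, rfl⟩ := v.surjective i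
    simp only [Equiv.Perm.mul_apply, Equiv.Perm.inv_def, Equiv.symm_apply_apply, Nat.lt_one_iff]
    rw [hv.val_apply_eq_zero_iff hsum, ← hk, ← hw, ← Fin.ext_iff, ← Fin.ext_iff,
      w.injective.eq_iff]

theorem skSet_eq_image (hv : IsVk 1 l2 k v) (hsum : 1 + l2 = n) (kk : Fin n)
    (hk : (kk : ℕ) = k) (h : Fin n → Fin n) :
    SkSet h v = (Finset.univ.filter fun p : Fin n => p < kk ∧ kk ≤ h p).image
      fun p => (v kk, v p) := by
  have hvk : (v kk : ℕ) = 0 := (hv.val_apply_eq_zero_iff hsum kk).mpr hk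
  ext ⟨a, b⟩
  obtain ⟨a, rfl⟩ := v.surjective a
  obtain ⟨b, rfl⟩ := v.surjective b
  simp only [SkSet, Finset.mem_filter, Finset.mem_univ, true_and, Equiv.Perm.inv_def, Equiv.symm_apply_apply,
    Finset.mem_image, Prod.mk.injEq, v.injective.eq_iff]
  constructor
  · rintro ⟨hab, hba, hle⟩
    have hak : a = kk := by
      have ha := hv a
      have hb := hv b
      rw [Fin.lt_def] at hab hba
      rw [Fin.ext_iff]
      split_ifs at ha hb <;> omega
    subst hak
    exact ⟨b, ⟨hba, hle⟩, rfl, rfl⟩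
  · rintro ⟨p, ⟨hp, hle⟩, rfl, rfl⟩
    refine ⟨?_, hp, hle⟩
    have := hv.val_apply_of_lt (p := p) (by rw [← hk]; exact hp)
    rw [Fin.lt_def]
    omega

theorem prod_skSet (hv : IsVk 1 l2 k v) (hsum : 1 + l2 = n) (kk : Fin n)
    (hk : (kk : ℕ) = k) (h : Fin n → Fin n) (y : Equiv.Perm (Fin n)) :
    ∏ p ∈ SkSet h v, (X (y p.1) - X (y p.2) : MvPolynomial (Fin n) ℂ) =
      positionProd (Finset.univ.filter fun p : Fin n => p < kk ∧ kk ≤ h p) (y * v)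
        (y (v kk)) := by
  rw [skSet_eq_image hv hsum kk hk, Finset.prod_image]
  · rfl
  · intro p _ q _ hpq
    exact v.injective (Prod.ext_iff.mp hpq).2

theorem rename_inv_positionProd (S : Finset (Fin n)) (v w : Equiv.Perm (Fin n)) (i : Fin n) :
    rename (⇑v⁻¹) (positionProd S (v * w) (v i) : MvPolynomial (Fin n) ℂ) =
      positionProd S w i := by
  simp [positionProd, map_prod]

end YoungOne

/-- Theorem 6.2 / `theorem:linear-ind2`: for `λ = (1, n-1)` and a connected
Hessenberg function `h` with `h(1) < n-1` and equal degree counts (both `≥ 2`), the union of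
the `S_n`-orbits of `f = f_λ^{(n-2)}` and `g = f_λ^{(n-1)}`, i.e. the `2n` functions
`f_i = u_i⁻¹ · f` and `g_i = u_i⁻¹ · g`, is linearly independent over `R = ℂ[t_1,…,t_n]`. -/
theorem statement3 (n : ℕ) (h : Fin n → Fin n) (hmono : Monotone h) (hgrow : ∀ i, i ≤ h i)
    (l2 : ℕ) (hl2 : 0 < l2) (hsum : 1 + l2 = n)
    (hconn : ∀ p : Fin n, (p : ℕ) + 1 < n → (p : ℕ) < (h p : ℕ))
    (hh1 : ∀ h0 : 0 < n, (h ⟨0, h0⟩ : ℕ) + 2 < n)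
    (hcard :
      (Finset.univ.filter fun p : Fin n => (p : ℕ) + 2 < n ∧ n ≤ (h p : ℕ) + 2).card =
      (Finset.univ.filter fun p : Fin n => (p : ℕ) + 1 < n ∧ (h p : ℕ) + 1 = n).card)
    (hcard2 :
      2 ≤ (Finset.univ.filter fun p : Fin n => (p : ℕ) + 2 < n ∧ n ≤ (h p : ℕ) + 2).card)
    (u : ℕ → Equiv.Perm (Fin n)) (hu : ∀ j ≤ l2, IsVk 1 l2 j (u j))
    (k2 : ℕ) (hk2 : k2 + 1 = l2)
    (f : Equiv.Perm (Fin n) → MvPolynomial (Fin n) ℂ)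
    (hfval : ∀ j, k2 ≤ j → j ≤ l2 → ∀ y : Equiv.Perm (Fin n), YoungTwo 1 y →
      f (y * u j) = ∏ p ∈ SkSet h (u k2), (X (y p.1) - X (y p.2)))
    (hfzero : ∀ w : Equiv.Perm (Fin n),
      (¬ ∃ j, k2 ≤ j ∧ j ≤ l2 ∧ ∃ y : Equiv.Perm (Fin n), YoungTwo 1 y ∧ w = y * u j) →
      f w = 0)
    (g : Equiv.Perm (Fin n) → MvPolynomial (Fin n) ℂ)
    (hgval : ∀ y : Equiv.Perm (Fin n), YoungTwo 1 y →
      g (y * u l2) = ∏ p ∈ SkSet h (u l2), (X (y p.1) - X (y p.2)))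
    (hgzero : ∀ w : Equiv.Perm (Fin n),
      (¬ ∃ y : Equiv.Perm (Fin n), YoungTwo 1 y ∧ w = y * u l2) → g w = 0) :
    LinearIndependent (MvPolynomial (Fin n) ℂ)
      (Sum.elim (fun i : Fin n => dot ((u (i : ℕ)))⁻¹ f)
        (fun i : Fin n => dot ((u (i : ℕ)))⁻¹ g)) := by
  obtain ⟨m, hm⟩ : ∃ m : Fin n, (m : ℕ) = k2 := ⟨⟨k2, by omega⟩, rfl⟩
  obtain ⟨l, hl⟩ : ∃ l : Fin n, (l : ℕ) = l2 := ⟨⟨l2, by omega⟩, rfl⟩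
  obtain ⟨o, ho⟩ : ∃ o : Fin n, (o : ℕ) = 0 := ⟨⟨0, by omega⟩, rfl⟩
  have hho : (h o : ℕ) + 2 < n := by
    have ho' : o = ⟨0, by omega⟩ := Fin.ext ho
    rw [ho']
    exact hh1 _
  have hum := hu k2 (by omega)
  have hul := hu l2 le_rfl
  set A := Finset.univ.filter fun p : Fin n => p < m ∧ m ≤ h p with hA
  set B := Finset.univ.filter fun p : Fin n => p < l ∧ l ≤ h p with hB
  have hA' : (Finset.univ.filter fun p : Fin n => (p : ℕ) + 2 < n ∧ n ≤ (h p : ℕ) + 2) = A :=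
    Finset.filter_congr fun p _ => by rw [Fin.lt_def, Fin.le_def]; omega
  have hB' : (Finset.univ.filter fun p : Fin n => (p : ℕ) + 1 < n ∧ (h p : ℕ) + 1 = n) = B :=
    Finset.filter_congr fun p _ => by rw [Fin.lt_def, Fin.le_def]; omega
  rw [hA', hB'] at hcard
  rw [hA'] at hcard2
  have mem_A (p : Fin n) : p ∈ A ↔ (p : ℕ) < k2 ∧ k2 ≤ (h p : ℕ) := by
    simp [hA, Fin.lt_def, Fin.le_def, hm]
  have mem_B (p : Fin n) : p ∈ B ↔ (p : ℕ) < l2 ∧ l2 ≤ (h p : ℕ) := by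
    simp [hB, Fin.lt_def, Fin.le_def, hl]
  have hmA : m ∉ A := by rw [mem_A]; omega
  have hmB : m ∈ B := by
    have := hconn m (by omega)
    rw [mem_B]; omega
  obtain ⟨p, hpA, hpB⟩ : ∃ p ∈ A, p ∉ B := by
    by_contra! hAB
    exact hmA (Finset.eq_of_subset_of_card_le hAB hcard.ge ▸ hmB)
  obtain ⟨q, hqB, hqm⟩ : ∃ q ∈ B, q ≠ m :=
    Finset.exists_mem_ne (by omega) m
  have hqA : q ∈ A := by
    rw [Ne, Fin.ext_iff] at hqm
    rw [mem_B] at hqB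
    rw [mem_A]; omega
  have hf (w : Equiv.Perm (Fin n)) (i : Fin n) (hi : (i : ℕ) = 0) :
      f w = if i = w m ∨ i = w l then positionProd A w i else 0 := by
    have hiff (x : Fin n) : i = w x ↔ (w x : ℕ) = 0 := by rw [Fin.ext_iff, hi, eq_comm]
    simp only [hiff]
    have hval (j : ℕ) (hj : k2 ≤ j) (hj' : j ≤ l2) (jj : Fin n) (hjj : (jj : ℕ) = j)
        (hw : (w jj : ℕ) = 0) : f w = positionProd A w i := by
      have hy := (youngTwo_mul_inv_iff (hu j hj') hsum jj hjj w).mpr hw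
      have hfw := hfval j hj hj' _ hy
      rw [inv_mul_cancel_right, prod_skSet hum hsum m hm] at hfw
      have hi' : (w * (u j)⁻¹) (u k2 m) = i := by
        have hz : u k2 m = u j jj := by
          rw [Fin.ext_iff, (hum.val_apply_eq_zero_iff hsum m).mpr hm,
            ((hu j hj').val_apply_eq_zero_iff hsum jj).mpr hjj]
        rw [hz, Equiv.Perm.mul_apply, Equiv.Perm.inv_def, Equiv.symm_apply_apply]
        exact Fin.ext (hw.trans hi.symm)
      rw [hfw, hi']
      refine Finset.prod_congr rfl fun x hx => ?_
      have hx' := ((mem_A x).mp hx).1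
      have hux : u k2 x = u j x := by
        rw [Fin.ext_iff, hum.val_apply_of_lt hx', (hu j hj').val_apply_of_lt (by omega)]
      rw [Equiv.Perm.mul_apply, hux, Equiv.Perm.mul_apply, Equiv.Perm.inv_def, Equiv.symm_apply_apply]
    split_ifs with hw
    · rcases hw with hw | hw
      · exact hval k2 le_rfl (by omega) m hm hw
      · exact hval l2 (by omega) le_rfl l hl hw
    · refine hfzero w ?_
      rintro ⟨j, hj, hj', y, hy, rfl⟩
      obtain rfl | rfl : j = k2 ∨ j = l2 := by omega
      · exact hw (.inl ((youngTwo_mul_inv_iff hum hsum m hm _).mp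
          (by rwa [mul_inv_cancel_right])))
      · exact hw (.inr ((youngTwo_mul_inv_iff hul hsum l hl _).mp
          (by rwa [mul_inv_cancel_right])))
  have hg (w : Equiv.Perm (Fin n)) (i : Fin n) (hi : (i : ℕ) = 0) :
      g w = if i = w l then positionProd B w i else 0 := by
    have hiff : i = w l ↔ (w l : ℕ) = 0 := by rw [Fin.ext_iff, hi, eq_comm]
    split_ifs with hw
    · have hy := (youngTwo_mul_inv_iff hul hsum l hl w).mpr (hiff.mp hw)
      have hgw := hgval _ hy
      rwa [inv_mul_cancel_right, prod_skSet hul hsum l hl, inv_mul_cancel_right,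
        Equiv.Perm.mul_apply, Equiv.Perm.inv_def, Equiv.symm_apply_apply, ← hw] at hgw
    · refine hgzero w ?_
      rintro ⟨y, hy, rfl⟩
      exact hw (hiff.mpr ((youngTwo_mul_inv_iff hul hsum l hl _).mp
        (by rwa [mul_inv_cancel_right])))
  have hui (i : Fin n) : (u i i : ℕ) = 0 :=
    ((hu i (by omega)).val_apply_eq_zero_iff hsum i).mpr rfl
  refine linearIndependent_positionProd (A := A) (B := B) (m := m) (l := l) (o := o)
    ?_ hmA ?_ ?_ hpA hpB hqA hqB ?_ ?_ ?_ _ _ (fun i w => ?_) fun i w => ?_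
  · rw [Ne, Fin.ext_iff]; omega
  · rw [mem_A]; omega
  · rw [mem_B]; omega
  · rw [mem_A]; omega
  · rw [Ne, Fin.ext_iff]; omega
  · rw [Ne, Fin.ext_iff]; omega
  · rw [dot, inv_inv, hf _ (u i i) (hui i), apply_ite (rename _), rename_inv_positionProd,
      map_zero]
    simp only [Equiv.Perm.mul_apply, (u i).injective.eq_iff]
  · rw [dot, inv_inv, hg _ (u i i) (hui i), apply_ite (rename _), rename_inv_positionProd,
      map_zero]
    simp only [Equiv.Perm.mul_apply, (u i).injective.eq_iff]
end

section
/- Let h be a Hessenberg function on {1,…,n}, λ = (λ_1, λ_2) a composition of n with two positive parts, and 0 ≤ k ≤ λ_2. Then: (1) y · f_λ^{(k)} = f_λ^{(k)} for every y ∈ S_λ, where · denotes the dot action; and (2) for every y ∈ S_λ and every w ∈ S_n, f_λ^{(k)}(yw) = y(f_λ^{(k)}(w)), where y acts on the polynomial f_λ^{(k)}(w) by permuting variables. -/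
open MvPolynomial Finset

/-- Lemma 4.4 / `lemma: fk def`(2),(3): `f_λ^{(k)}` is fixed by `S_λ` under
the dot action, and `f_λ^{(k)}(y w) = y (f_λ^{(k)}(w))` for `y ∈ S_λ`. -/
theorem statement8 (n : ℕ) (h : Fin n → Fin n) (hmono : Monotone h) (hgrow : ∀ i, i ≤ h i)
    (l1 l2 k : ℕ) (hl1 : 0 < l1) (hl2 : 0 < l2) (hsum : l1 + l2 = n) (hk : k ≤ l2)
    (v : ℕ → Equiv.Perm (Fin n)) (hv : ∀ j ≤ l2, IsVk l1 l2 j (v j))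
    (f : Equiv.Perm (Fin n) → MvPolynomial (Fin n) ℂ)
    (hfval : ∀ j, k ≤ j → j ≤ l2 → ∀ y : Equiv.Perm (Fin n), YoungTwo l1 y →
      f (y * v j) = ∏ p ∈ SkSet h (v k), (X (y p.1) - X (y p.2)))
    (hfzero : ∀ w : Equiv.Perm (Fin n),
      (¬ ∃ j, k ≤ j ∧ j ≤ l2 ∧ ∃ y : Equiv.Perm (Fin n), YoungTwo l1 y ∧ w = y * v j) →
      f w = 0) :
    (∀ y : Equiv.Perm (Fin n), YoungTwo l1 y → dot y f = f) ∧
    (∀ y : Equiv.Perm (Fin n), YoungTwo l1 y → ∀ w : Equiv.Perm (Fin n),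
      f (y * w) = rename (⇑y) (f w)) := by
  have equivariant : ∀ y : Equiv.Perm (Fin n), YoungTwo l1 y → ∀ w : Equiv.Perm (Fin n),
      f (y * w) = rename (⇑y) (f w) := by
    intro y hy w
    by_cases hw : ∃ j, k ≤ j ∧ j ≤ l2 ∧ ∃ z : Equiv.Perm (Fin n), YoungTwo l1 z ∧ w = z * v j
    · obtain ⟨j, hkj, hj, z, hz, rfl⟩ := hw
      rw [← mul_assoc, hfval j hkj hj _ (hy.mul hz), hfval j hkj hj z hz, map_prod]
      simp
    · rw [hfzero w hw, map_zero]
      refine hfzero _ fun ⟨j, hkj, hj, z, hz, hyw⟩ => hw ⟨j, hkj, hj, y⁻¹ * z, hy.inv.mul hz, ?_⟩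
      rw [mul_assoc, ← hyw, inv_mul_cancel_left]
  refine ⟨fun y hy => funext fun w => ?_, equivariant⟩
  rw [dot, ← equivariant y hy, mul_inv_cancel_left]
end

section
/- Let h be a Hessenberg function on {1,…,n}, λ = (λ_1, λ_2) a composition of n with two positive parts, and 0 ≤ k ≤ λ_2. Let v ∈ S_n satisfy v(1) < v(2) < ⋯ < v(λ_1) and v(λ_1+1) < ⋯ < v(n) (i.e., v is a shortest left coset representative of S_n/S_λ). Then for every w ∈ S_n: if v⁻¹w ∈ S_λ v_j for some j with k ≤ j ≤ λ_2, then (v · f_λ^{(k)})(w) = ∏_{(a,b)∈𝒮_k} (t_{w(v_j⁻¹(a))} − t_{w(v_j⁻¹(b))}); otherwise (v · f_λ^{(k)})(w) = 0. In particular, the support {w : (v · f_λ^{(k)})(w) ≠ 0} equals the disjoint union over k ≤ j ≤ λ_2 of the sets v S_λ v_j. -/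
open MvPolynomial Finset

/-- The only position `≤ l2` at which `v_j` takes a value `< l1` is `j`. -/
theorem IsVk.lt_iff {n l1 l2 j : ℕ} (hl1 : 0 < l1) {v : Equiv.Perm (Fin n)}
    (hv : IsVk l1 l2 j v) (p : Fin n) (hp : (p : ℕ) ≤ l2) :
    (v p : ℕ) < l1 ↔ (p : ℕ) = j := by
  rw [hv p]
  split_ifs <;> omega

/-- The cosets `S_λ v_j` are pairwise disjoint. -/
theorem IsVk.eq_of_mul_eq_mul {n l1 l2 j j' : ℕ} (hl1 : 0 < l1) (hsum : l1 + l2 = n)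
    (hj : j ≤ l2) {v v' y y' : Equiv.Perm (Fin n)}
    (hv : IsVk l1 l2 j v) (hv' : IsVk l1 l2 j' v')
    (hy : YoungTwo l1 y) (hy' : YoungTwo l1 y') (h : y * v = y' * v') : j = j' := by
  have hp : y (v ⟨j, by omega⟩) = y' (v' ⟨j, by omega⟩) := DFunLike.congr_fun h _
  have h1 := (hy _).2 ((hv.lt_iff hl1 ⟨j, by omega⟩ hj).2 rfl)
  rw [hp, hy'] at h1
  exact (hv'.lt_iff hl1 ⟨j, by omega⟩ hj).1 h1

theorem prod_SkSet_ne_zero {n : ℕ} (h : Fin n → Fin n) (vk x : Equiv.Perm (Fin n)) :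
    (∏ p ∈ SkSet h vk, (X (x p.1) - X (x p.2)) : MvPolynomial (Fin n) ℂ) ≠ 0 := by
  refine Finset.prod_ne_zero_iff.2 fun p hp => sub_ne_zero.2 fun he => ?_
  exact (Finset.mem_filter.1 hp).2.1.ne (x.injective (MvPolynomial.X_injective he))

/-- Lemma 4.13 / `lem.left-coset-support`: values and support of
`v · f_λ^{(k)}` for a shortest left coset representative `v` of `S_n / S_λ`. -/
theorem statement9 (n : ℕ) (h : Fin n → Fin n) (hmono : Monotone h) (hgrow : ∀ i, i ≤ h i)
    (l1 l2 k : ℕ) (hl1 : 0 < l1) (hl2 : 0 < l2) (hsum : l1 + l2 = n) (hk : k ≤ l2)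
    (v : ℕ → Equiv.Perm (Fin n)) (hv : ∀ j ≤ l2, IsVk l1 l2 j (v j))
    (f : Equiv.Perm (Fin n) → MvPolynomial (Fin n) ℂ)
    (hfval : ∀ j, k ≤ j → j ≤ l2 → ∀ y : Equiv.Perm (Fin n), YoungTwo l1 y →
      f (y * v j) = ∏ p ∈ SkSet h (v k), (X (y p.1) - X (y p.2)))
    (hfzero : ∀ w : Equiv.Perm (Fin n),
      (¬ ∃ j, k ≤ j ∧ j ≤ l2 ∧ ∃ y : Equiv.Perm (Fin n), YoungTwo l1 y ∧ w = y * v j) →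
      f w = 0)
    (u : Equiv.Perm (Fin n))
    (hu1 : ∀ p q : Fin n, p < q → (q : ℕ) < l1 → u p < u q)
    (hu2 : ∀ p q : Fin n, p < q → l1 ≤ (p : ℕ) → u p < u q) :
    (∀ w : Equiv.Perm (Fin n), ∀ j, k ≤ j → j ≤ l2 →
      ∀ y : Equiv.Perm (Fin n), YoungTwo l1 y → u⁻¹ * w = y * v j →
      dot u f w = ∏ p ∈ SkSet h (v k),
        (X (w ((v j)⁻¹ p.1)) - X (w ((v j)⁻¹ p.2)))) ∧
    (∀ w : Equiv.Perm (Fin n),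
      (¬ ∃ j, k ≤ j ∧ j ≤ l2 ∧ ∃ y : Equiv.Perm (Fin n), YoungTwo l1 y ∧ u⁻¹ * w = y * v j) →
      dot u f w = 0) ∧
    ({w : Equiv.Perm (Fin n) | dot u f w ≠ 0} =
      {w : Equiv.Perm (Fin n) |
        ∃ j, k ≤ j ∧ j ≤ l2 ∧ ∃ y : Equiv.Perm (Fin n), YoungTwo l1 y ∧ w = u * y * v j}) ∧
    (∀ j j', k ≤ j → j ≤ l2 → k ≤ j' → j' ≤ l2 → j ≠ j' →
      ∀ w : Equiv.Perm (Fin n),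
        (∃ y : Equiv.Perm (Fin n), YoungTwo l1 y ∧ w = u * y * v j) →
        ¬ ∃ y : Equiv.Perm (Fin n), YoungTwo l1 y ∧ w = u * y * v j') := by
  have hval : ∀ j, k ≤ j → j ≤ l2 → ∀ y : Equiv.Perm (Fin n), YoungTwo l1 y →
      ∀ w, u⁻¹ * w = y * v j →
      dot u f w = ∏ p ∈ SkSet h (v k), (X ((u * y) p.1) - X ((u * y) p.2)) := by
    intro j hkj hj y hy w hw
    simp [dot, hw, hfval j hkj hj y hy]
  have hzero : ∀ w : Equiv.Perm (Fin n),
      (¬ ∃ j, k ≤ j ∧ j ≤ l2 ∧ ∃ y : Equiv.Perm (Fin n), YoungTwo l1 y ∧ u⁻¹ * w = y * v j) →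
      dot u f w = 0 := by
    intro w hw
    simp [dot, hfzero _ hw]
  refine ⟨fun w j hkj hj y hy hw => ?_, hzero, Set.ext fun w => ⟨fun hw => ?_, ?_⟩, ?_⟩
  · obtain rfl : w = u * y * v j := by rw [mul_assoc, ← hw, mul_inv_cancel_left]
    rw [hval j hkj hj y hy _ hw]
    simp
  · by_contra hcon
    refine hw (hzero w ?_)
    rintro ⟨j, hkj, hj, y, hy, e⟩
    exact hcon ⟨j, hkj, hj, y, hy, by rw [mul_assoc, ← e, mul_inv_cancel_left]⟩
  · rintro ⟨j, hkj, hj, y, hy, rfl⟩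
    rw [Set.mem_ofPred_eq, hval j hkj hj y hy _ (by group)]
    exact prod_SkSet_ne_zero h (v k) (u * y)
  · rintro j j' - hj - hj' hne w ⟨y, hy, rfl⟩ ⟨y', hy', e⟩
    rw [mul_assoc, mul_assoc] at e
    exact hne ((hv j hj).eq_of_mul_eq_mul hl1 hsum hj (hv j' hj') hy hy' (mul_left_cancel e))
end

section
/- Let λ = (λ_1, λ_2) be a composition of n with two positive parts and 0 ≤ k ≤ λ_2. Then the inversion set of v_k⁻¹, namely {(a,b) : 1 ≤ a < b ≤ n and v_k⁻¹(a) > v_k⁻¹(b)}, equals the disjoint union {(1,b) : λ_1+1 ≤ b ≤ λ_1+k} ⊔ {(a,b) : 2 ≤ a ≤ λ_1 and λ_1+1 ≤ b ≤ n}. -/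
open MvPolynomial Finset

/-- Lemma 4.3 / `lemma.vk-invs`: description of the inversion set of
`v_k⁻¹` (0-based indices: `1` becomes `0`, `b ∈ {λ₁+1,…,λ₁+k}` becomes `l1 ≤ b < l1 + k`,
`a ∈ {2,…,λ₁}` becomes `1 ≤ a < l1`, `b ∈ {λ₁+1,…,n}` becomes `l1 ≤ b`). -/
theorem statement15 (n : ℕ) (l1 l2 k : ℕ) (hl1 : 0 < l1) (hl2 : 0 < l2)
    (hsum : l1 + l2 = n) (hk : k ≤ l2)
    (vk : Equiv.Perm (Fin n)) (hvk : IsVk l1 l2 k vk) :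
    (Finset.univ.filter fun p : Fin n × Fin n => p.1 < p.2 ∧ vk⁻¹ p.2 < vk⁻¹ p.1) =
      Finset.univ.filter fun p : Fin n × Fin n =>
        ((p.1 : ℕ) = 0 ∧ l1 ≤ (p.2 : ℕ) ∧ (p.2 : ℕ) < l1 + k) ∨
        (1 ≤ (p.1 : ℕ) ∧ (p.1 : ℕ) < l1 ∧ l1 ≤ (p.2 : ℕ)) := by
  ext ⟨a, b⟩
  obtain ⟨p, rfl⟩ := vk.surjective a
  obtain ⟨q, rfl⟩ := vk.surjective b
  have hp := hvk p
  have hq := hvk q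
  have := p.isLt
  have := q.isLt
  have inv_apply (x : Fin n) : vk⁻¹ (vk x) = x := vk.symm_apply_apply x
  simp only [mem_filter, mem_univ, true_and, inv_apply, Fin.lt_def]
  split_ifs at hp hq <;> omega
end
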